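/- arXiv:1805.02239 — 4 statements merged into one kernel-verified Lean document; each statement's English description precedes it below -/
import Mathlib

section
/- For all real numbers a, b with 0 < a < b there exists a function d : ℝ → ℝ such that: d is C^∞ on the interval (0, ∞); d(x) = x for every x ∈ (0, a]; d is strictly increasing on (0, ∞); d maps (0, ∞) bijectively onto (0, b); and the inverse map (0, b) → (0, ∞) of this bijection is C^∞ on (0, b). (In other words, d restricts to a smooth diffeomorphism of (0, ∞) onto (0, b) which is the identity on (0, a].) -/
open Set

/-- For `0 < a < b` there is a function `d : ℝ → ℝ` that is `C^∞` on `(0,∞)`,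
equals the identity on `(0,a]`, is strictly increasing on `(0,∞)`, maps `(0,∞)`
bijectively onto `(0,b)`, and whose inverse is `C^∞` on `(0,b)`. -/
theorem stmt_0 (a b : ℝ) (ha : 0 < a) (hab : a < b) :
    ∃ d : ℝ → ℝ,
      ContDiffOn ℝ (⊤ : ℕ∞) d (Ioi 0) ∧
      (∀ x ∈ Ioc 0 a, d x = x) ∧
      StrictMonoOn d (Ioi 0) ∧
      BijOn d (Ioi 0) (Ioo 0 b) ∧
      ∃ e : ℝ → ℝ,
        ContDiffOn ℝ (⊤ : ℕ∞) e (Ioo 0 b) ∧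
        (∀ x ∈ Ioi (0 : ℝ), e (d x) = x) ∧
        (∀ y ∈ Ioo 0 b, d (e y) = y) := by
  let e : ℝ → ℝ := fun y => y + expNegInvGlue (y - a) / (b - y)
  have hsm : ContDiffOn ℝ (⊤ : ℕ∞) e (Iio b) := by
    apply ContDiffOn.add contDiffOn_id
    apply ContDiffOn.div
    · exact (expNegInvGlue.contDiff.comp (contDiff_id.sub contDiff_const)).contDiffOn
    · exact (contDiff_const.sub contDiff_id).contDiffOn
    · intro x hx
      have : x < b := hx
      exact (sub_pos.2 this).ne'
  have hid : ∀ y ≤ a, e y = y := by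
    intro y hy
    simp [e, expNegInvGlue.zero_of_nonpos (sub_nonpos.2 hy)]
  have hmono : StrictMonoOn e (Iio b) := by
    intro x hx y hy hxy
    have hx' : 0 < b - x := sub_pos.2 hx
    have hy' : 0 < b - y := sub_pos.2 hy
    have : expNegInvGlue (x - a) / (b - x) ≤ expNegInvGlue (y - a) / (b - y) :=
      div_le_div₀ (expNegInvGlue.nonneg _) (expNegInvGlue.monotone (by linarith)) hy' (by linarith)
    exact add_lt_add_of_lt_of_le hxy this
  have hderiv : ∀ y < b, ∃ c : ℝ, c ≠ 0 ∧ HasDerivAt e c y := by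
    intro y hy
    have hy' : 0 < b - y := sub_pos.2 hy
    have h1 : HasDerivAt (fun y => expNegInvGlue (y - a)) (deriv expNegInvGlue (y - a)) y := by
      have hd : DifferentiableAt ℝ expNegInvGlue (y - a) :=
        (expNegInvGlue.contDiff (n := 1)).differentiable (by norm_num) _
      simpa using hd.hasDerivAt.comp_sub_const y a
    have h2 : HasDerivAt (fun y => b - y) (-1) y := by
      simpa using (hasDerivAt_id y).const_sub b
    refine ⟨_, ?_, (hasDerivAt_id y).add (h1.div h2 hy'.ne')⟩
    have h3 : 0 ≤ deriv expNegInvGlue (y - a) := expNegInvGlue.monotone.deriv_nonneg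
    have h4 := expNegInvGlue.nonneg (y - a)
    have : 0 ≤ (deriv expNegInvGlue (y - a) * (b - y) - expNegInvGlue (y - a) * -1) / (b - y) ^ 2 := by
      apply div_nonneg _ (sq_nonneg _)
      have := mul_nonneg h3 hy'.le
      linarith
    linarith
  have hsurj : ∀ t : ℝ, ∃ y, y < b ∧ e y = t := by
    intro t
    have hc : 0 < expNegInvGlue ((b - a) / 2) := expNegInvGlue.pos_of_pos (by linarith)
    set c := expNegInvGlue ((b - a) / 2) with hcdef
    have ht : 0 < |t| + 1 := by positivity
    set δ := min ((b - a) / 2) (c / (|t| + 1)) with hδ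
    have hδ0 : 0 < δ := lt_min (by linarith) (by positivity)
    have hδ1 : δ ≤ (b - a) / 2 := min_le_left _ _
    have hδ2 : δ ≤ c / (|t| + 1) := min_le_right _ _
    have h2 : t ≤ e (b - δ) := by
      have h5 : c ≤ expNegInvGlue (b - δ - a) := expNegInvGlue.monotone (by linarith)
      have h6 : |t| + 1 ≤ expNegInvGlue (b - δ - a) / (b - (b - δ)) := by
        rw [sub_sub_cancel, le_div_iff₀ hδ0]
        rw [le_div_iff₀ ht] at hδ2
        linarith
      have := le_abs_self t
      change t ≤ (b - δ) + _
      linarith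
    have h1 : e (min t a) ≤ t := by
      rw [hid _ (min_le_right _ _)]; exact min_le_left _ _
    have hle : min t a ≤ b - δ := (min_le_right _ _).trans (by linarith)
    have hcont : ContinuousOn e (Icc (min t a) (b - δ)) :=
      hsm.continuousOn.mono fun x hx => lt_of_le_of_lt hx.2 (by linarith)
    obtain ⟨y, hy, rfl⟩ := intermediate_value_Icc hle hcont ⟨h1, h2⟩
    exact ⟨y, lt_of_le_of_lt hy.2 (by linarith), rfl⟩
  choose d hdb hed using hsurj
  have hde : ∀ y < b, d (e y) = y := fun y hy => hmono.injOn (hdb _) hy (hed _)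
  have hdm : StrictMono d := by
    intro x y hxy
    by_contra! h
    have := hmono.monotoneOn (hdb y) (hdb x) h
    rw [hed, hed] at this
    linarith
  have hdc : Continuous d := by
    rw [continuous_iff_continuousAt]
    intro x
    refine (hdm.strictMonoOn univ).continuousAt_of_image_mem_nhds Filter.univ_mem ?_
    exact Filter.mem_of_superset (Iio_mem_nhds (hdb x)) fun y hy => ⟨e y, mem_univ _, hde y hy⟩
  let f : OpenPartialHomeomorph ℝ ℝ :=
    { toFun := e
      invFun := d
      source := Iio b
      target := univ
      map_source' := fun _ _ => mem_univ _
      map_target' := fun x _ => hdb x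
      left_inv' := fun y hy => hde y hy
      right_inv' := fun x _ => hed x
      open_source := isOpen_Iio
      open_target := isOpen_univ
      continuousOn_toFun := hsm.continuousOn
      continuousOn_invFun := hdc.continuousOn }
  have hdsm : ∀ x, ContDiffAt ℝ (⊤ : ℕ∞) d x := by
    intro x
    obtain ⟨c, hc, hcd⟩ := hderiv (d x) (hdb x)
    exact f.contDiffAt_symm_deriv hc (mem_univ x) hcd (hsm.contDiffAt (Iio_mem_nhds (hdb x)))
  have hd0 : ∀ x ≤ a, d x = x := fun x hx => by
    have := hde x (by linarith)
    rwa [hid x hx] at this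
  refine ⟨d, fun x _ => (hdsm x).contDiffWithinAt, fun x hx => hd0 x hx.2, hdm.strictMonoOn _,
    ⟨?_, hdm.injective.injOn, ?_⟩, e, hsm.mono fun x hx => hx.2, fun x _ => hed x,
    fun y hy => hde y hy.2⟩
  · intro x hx
    refine ⟨?_, hdb x⟩
    have := hdm (show 0 < x from hx)
    rwa [hd0 0 ha.le] at this
  · intro y hy
    refine ⟨e y, ?_, hde y hy.2⟩
    have := hmono (show (0:ℝ) ∈ Iio b from ha.trans hab) hy.2 hy.1
    rwa [hid 0 ha.le] at this
end

section
/- There exists a function h : ℝ → ℝ with the following properties: h is C^∞ on (−∞, 0); the image of (−∞, 0) under h equals the half-open interval [0, 1); h(x) = 0 for every x ≤ −1; the first derivative h′ and the second derivative h″ are strictly positive at every point of (−1, 0); and there exists a function H : ℝ → ℝ which is C^∞ on (0, ∞), satisfies H(t) = 0 for every t ≥ 1, and satisfies H(h(x)) = x for every x ∈ (−1, 0) (so H extends the inverse of the restriction of h to (−1, 0)). -/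
open Set

namespace ConvexCutoff

noncomputable def T (x : ℝ) : ℝ := Real.exp 1 * (x * expNegInvGlue x)
noncomputable def D (x : ℝ) : ℝ := (1 + x⁻¹) * Real.exp (1 - x⁻¹)
noncomputable def D2 (x : ℝ) : ℝ := (x⁻¹) ^ 3 * Real.exp (1 - x⁻¹)

lemma T_smooth : ContDiff ℝ (⊤ : ℕ∞) T :=
  contDiff_const.mul (contDiff_id.mul expNegInvGlue.contDiff)

lemma T_nonpos {x : ℝ} (hx : x ≤ 0) : T x = 0 := by
  simp [T, expNegInvGlue.zero_of_nonpos hx]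

lemma T_eq {x : ℝ} (hx : 0 < x) : T x = x * Real.exp (1 - x⁻¹) := by
  simp only [T, expNegInvGlue, not_le.2 hx, if_false, sub_eq_add_neg, Real.exp_add]
  ring

lemma T_pos {x : ℝ} (hx : 0 < x) : 0 < T x := by
  rw [T_eq hx]; positivity

lemma T_one : T 1 = 1 := by rw [T_eq one_pos]; simp

lemma D_pos {x : ℝ} (hx : 0 < x) : 0 < D x := by unfold D; positivity
lemma D2_pos {x : ℝ} (hx : 0 < x) : 0 < D2 x := by unfold D2; positivity

lemma hasDerivAt_e {x : ℝ} (hx : 0 < x) :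
    HasDerivAt (fun y : ℝ => Real.exp (1 - y⁻¹)) (Real.exp (1 - x⁻¹) * (x⁻¹) ^ 2) x := by
  have h := ((hasDerivAt_inv hx.ne').const_sub 1).exp
  convert h using 1
  field_simp

lemma T_deriv {x : ℝ} (hx : 0 < x) : HasDerivAt T (D x) x := by
  have h := (hasDerivAt_id x).mul (hasDerivAt_e hx)
  have h2 : HasDerivAt (fun y : ℝ => y * Real.exp (1 - y⁻¹)) (D x) x := by
    refine HasDerivAt.congr_deriv h ?_
    simp only [D, id]
    field_simp
  refine h2.congr_of_eventuallyEq ?_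
  filter_upwards [Ioi_mem_nhds hx] with y hy using T_eq hy

lemma D_deriv {x : ℝ} (hx : 0 < x) : HasDerivAt D (D2 x) x := by
  have h := ((hasDerivAt_inv hx.ne').const_add 1).mul (hasDerivAt_e hx)
  refine HasDerivAt.congr_deriv h ?_
  simp only [D2]
  field_simp
  ring

lemma T_mono : StrictMonoOn T (Ioi 0) := by
  refine strictMonoOn_of_deriv_pos (convex_Ioi 0) T_smooth.continuous.continuousOn ?_
  intro x hx
  rw [interior_Ioi] at hx
  rw [(T_deriv hx).deriv]
  exact D_pos hx

lemma T_surj {y : ℝ} (hy : 0 < y) : ∃ x, 0 < x ∧ T x = y := by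
  have h1 : y ≤ T (y + 1) := by
    have hp : 0 < y + 1 := by linarith
    rw [T_eq hp]
    have := Real.add_one_le_exp (1 - (y + 1)⁻¹)
    have h3 : (y + 1) * (y + 1)⁻¹ = 1 := mul_inv_cancel₀ hp.ne'
    nlinarith
  have h0 : T 0 = 0 := T_nonpos le_rfl
  obtain ⟨x, hx, hxy⟩ := intermediate_value_Icc (by linarith : (0 : ℝ) ≤ y + 1)
    T_smooth.continuous.continuousOn (show y ∈ Icc (T 0) (T (y + 1)) from ⟨by linarith, h1⟩)
  refine ⟨x, ?_, hxy⟩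
  rcases hx.1.eq_or_lt with h | h
  · rw [← h, h0] at hxy; linarith
  · exact h

open Classical in
noncomputable def R (y : ℝ) : ℝ := if hy : 0 < y then (T_surj hy).choose else 0

lemma R_pos {y : ℝ} (hy : 0 < y) : 0 < R y := by
  rw [R, dif_pos hy]; exact (T_surj hy).choose_spec.1

lemma T_R {y : ℝ} (hy : 0 < y) : T (R y) = y := by
  rw [R, dif_pos hy]; exact (T_surj hy).choose_spec.2

lemma R_T {x : ℝ} (hx : 0 < x) : R (T x) = x :=
  T_mono.injOn (R_pos (T_pos hx)) hx (T_R (T_pos hx))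

lemma R_mono : StrictMonoOn R (Ioi 0) := by
  intro a ha b hb hab
  rw [← T_mono.lt_iff_lt (R_pos ha) (R_pos hb), T_R ha, T_R hb]
  exact hab

lemma R_cont {y : ℝ} (hy : 0 < y) : ContinuousAt R y := by
  refine R_mono.continuousAt_of_image_mem_nhds (Ioi_mem_nhds hy) ?_
  refine Filter.mem_of_superset (Ioi_mem_nhds (R_pos hy)) ?_
  intro x hx
  exact ⟨T x, T_pos hx, R_T hx⟩

noncomputable def TH : OpenPartialHomeomorph ℝ ℝ where
  toFun := T
  invFun := R
  source := Ioi 0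
  target := Ioi 0
  map_source' := fun _ hx => T_pos hx
  map_target' := fun _ hx => R_pos hx
  left_inv' := fun _ hx => R_T hx
  right_inv' := fun _ hx => T_R hx
  open_source := isOpen_Ioi
  open_target := isOpen_Ioi
  continuousOn_toFun := T_smooth.continuous.continuousOn
  continuousOn_invFun := fun _ hx => (R_cont hx).continuousWithinAt

lemma R_smooth {y : ℝ} (hy : 0 < y) : ContDiffAt ℝ (⊤ : ℕ∞) R y :=
  TH.contDiffAt_symm_deriv (D_pos (R_pos hy)).ne' hy (T_deriv (R_pos hy)) T_smooth.contDiffAt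

lemma R_deriv {y : ℝ} (hy : 0 < y) : HasDerivAt R (D (R y))⁻¹ y :=
  TH.hasDerivAt_symm hy (D_pos (R_pos hy)).ne' (T_deriv (R_pos hy))

lemma R_one : R 1 = 1 := by
  have := R_T one_pos
  rwa [T_one] at this

lemma R_lt_one {y : ℝ} (hy : 0 < y) (h : y < 1) : R y < 1 := by
  have := R_mono hy (show (1 : ℝ) ∈ Ioi 0 from mem_Ioi.2 one_pos) h
  rwa [R_one] at this

lemma R_ge_one {y : ℝ} (h : 1 ≤ y) : 1 ≤ R y := by
  have := R_mono.monotoneOn (show (1 : ℝ) ∈ Ioi 0 from mem_Ioi.2 one_pos)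
    (show y ∈ Ioi 0 from lt_of_lt_of_le one_pos h) h
  rwa [R_one] at this

noncomputable def G (y : ℝ) : ℝ := T (1 - R y)

lemma G_smooth {y : ℝ} (hy : 0 < y) : ContDiffAt ℝ (⊤ : ℕ∞) G y :=
  T_smooth.contDiffAt.comp y (contDiffAt_const.sub (R_smooth hy))

lemma G_zero {y : ℝ} (h : 1 ≤ y) : G y = 0 := T_nonpos (by linarith [R_ge_one h])

lemma G_mem {y : ℝ} (hy : 0 < y) (h : y < 1) : G y ∈ Ioo (0 : ℝ) 1 := by
  have h1 := R_lt_one hy h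
  have h2 : (0 : ℝ) < 1 - R y := by linarith
  refine ⟨T_pos h2, ?_⟩
  have := T_mono h2 (show (1 : ℝ) ∈ Ioi 0 from mem_Ioi.2 one_pos) (by linarith [R_pos hy])
  rwa [T_one] at this

lemma G_G {y : ℝ} (hy : 0 < y) (h : y < 1) : G (G y) = y := by
  have h1 := R_lt_one hy h
  have h2 : (0 : ℝ) < 1 - R y := by linarith
  unfold G
  rw [R_T h2, sub_sub_cancel, T_R hy]

lemma h_deriv {x : ℝ} (hx : x ∈ Ioo (-1 : ℝ) 0) :
    HasDerivAt (fun x => G (-x)) (D (1 - R (-x)) * (D (R (-x)))⁻¹) x := by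
  have hy : 0 < -x := by linarith [hx.2]
  have h1 := R_lt_one hy (by linarith [hx.1])
  have h2 : (0 : ℝ) < 1 - R (-x) := by linarith
  have hr : HasDerivAt (fun x => 1 - R (-x)) (D (R (-x)))⁻¹ x := by
    have := ((R_deriv hy).comp x (hasDerivAt_neg x)).const_sub 1
    refine HasDerivAt.congr_deriv this ?_
    ring
  exact (T_deriv h2).comp x hr

lemma h_deriv2 {x : ℝ} (hx : x ∈ Ioo (-1 : ℝ) 0) :
    ∃ c, 0 < c ∧ HasDerivAt (fun x => D (1 - R (-x)) * (D (R (-x)))⁻¹) c x := by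
  have hy : 0 < -x := by linarith [hx.2]
  have h1 := R_lt_one hy (by linarith [hx.1])
  have h2 : (0 : ℝ) < 1 - R (-x) := by linarith
  have hR : HasDerivAt (fun x => R (-x)) (-(D (R (-x)))⁻¹) x := by
    have := (R_deriv hy).comp x (hasDerivAt_neg x)
    refine HasDerivAt.congr_deriv this ?_
    ring
  have hr := hR.const_sub 1
  have hA : HasDerivAt (fun x => D (1 - R (-x)))
      (D2 (1 - R (-x)) * - -(D (R (-x)))⁻¹) x := HasDerivAt.comp (h₂ := D) x (D_deriv h2) hr
  have hC : HasDerivAt (fun x => D (R (-x)))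
      (D2 (R (-x)) * -(D (R (-x)))⁻¹) x :=
    HasDerivAt.comp (h₂ := D) x (D_deriv (R_pos hy)) hR
  have hB := hC.inv (D_pos (R_pos hy)).ne'
  refine ⟨_, ?_, hA.mul hB⟩
  have := D_pos h2
  have := D2_pos h2
  have := D_pos (R_pos hy)
  have := D2_pos (R_pos hy)
  simp only [Function.comp, neg_neg, mul_neg, Pi.inv_apply]
  positivity

end ConvexCutoff

open ConvexCutoff in
/-- There is a `C^∞` function `h` on `(-∞,0)` mapping `(-∞,0)` onto `[0,1)`,
vanishing on `(-∞,-1]`, with strictly positive first and second derivatives on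
`(-1,0)`, such that the inverse of `h|_{(-1,0)}` extends to a `C^∞` function `H`
on `(0,∞)` vanishing on `[1,∞)`. -/
theorem stmt_1 :
    ∃ h H : ℝ → ℝ,
      ContDiffOn ℝ (⊤ : ℕ∞) h (Iio 0) ∧
      h '' Iio 0 = Ico (0 : ℝ) 1 ∧
      (∀ x ≤ (-1 : ℝ), h x = 0) ∧
      (∀ x ∈ Ioo (-1 : ℝ) 0, 0 < deriv h x ∧ 0 < deriv (deriv h) x) ∧
      ContDiffOn ℝ (⊤ : ℕ∞) H (Ioi 0) ∧
      (∀ t ≥ (1 : ℝ), H t = 0) ∧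
      (∀ x ∈ Ioo (-1 : ℝ) 0, H (h x) = x) := by
  refine ⟨fun x => G (-x), fun t => -G t, ?_, ?_, ?_, ?_, ?_, ?_, ?_⟩
  · intro x hx
    have hy : 0 < -x := neg_pos.2 hx
    exact ((G_smooth hy).comp x contDiff_neg.contDiffAt).contDiffWithinAt
  · ext y
    constructor
    · rintro ⟨x, hx, rfl⟩
      have hy : 0 < -x := neg_pos.2 hx
      rcases lt_or_ge (-x) 1 with h | h
      · exact Ioo_subset_Ico_self (G_mem hy h)
      · simp [G_zero h]
    · rintro ⟨h0, h1⟩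
      rcases h0.eq_or_lt with h | h
      · exact ⟨-1, by simp, by simp [← h, G_zero le_rfl]⟩
      · exact ⟨-G y, by simpa using (G_mem h h1).1, by simp [G_G h h1]⟩
  · intro x hx
    exact G_zero (by linarith)
  · intro x hx
    have hy : 0 < -x := by linarith [hx.2]
    have h1 := R_lt_one hy (by linarith [hx.1])
    refine ⟨?_, ?_⟩
    · rw [(h_deriv hx).deriv]
      exact mul_pos (D_pos (by linarith)) (inv_pos.2 (D_pos (R_pos hy)))
    · obtain ⟨c, hc, hd⟩ := h_deriv2 hx
      have : deriv (fun x => G (-x)) =ᶠ[nhds x] fun x => D (1 - R (-x)) * (D (R (-x)))⁻¹ := by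
        filter_upwards [Ioo_mem_nhds hx.1 hx.2] with z hz using (h_deriv hz).deriv
      rw [this.deriv_eq, hd.deriv]
      exact hc
  · intro t ht
    exact (G_smooth ht).neg.contDiffWithinAt
  · intro t ht
    simp [G_zero ht]
  · intro x hx
    have := G_G (y := -x) (by linarith [hx.2]) (by linarith [hx.1])
    simp only [this, neg_neg]
end

section
/- Let k ≥ 2 be a natural number, let B be a nonempty connected topological manifold, let p : E → B be the projection of a fiber bundle with fiber the sphere S^{k−1}, let f : B′ → B be a surjective covering map where B′ is a nonempty topological manifold, and let p′ : f*E → B′ be the projection of the pullback bundle. Then there exists q ≥ 1 such that p is not π_q-surjective up to homotopy if and only if there exists q ≥ 1 such that p′ is not π_q-surjective up to homotopy. -/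
open Set

/-- The unit sphere `S^q ⊆ ℝ^{q+1}`. -/
abbrev Sph (q : ℕ) : Type :=
  ↥(Metric.sphere (0 : EuclideanSpace ℝ (Fin (q + 1))) 1)

/-- `p : E → B` is (the projection of) a fiber bundle with fiber `F`:
`p` is continuous and every point of `B` has an open neighborhood `U` with a
homeomorphism `p⁻¹(U) ≃ U × F` commuting with the projections to `U`. -/
def IsBundleWithFiber {E B : Type*} [TopologicalSpace E] [TopologicalSpace B]
    (F : Type*) [TopologicalSpace F] (p : E → B) : Prop :=
  Continuous p ∧ ∀ b : B, ∃ U : Set B, IsOpen U ∧ b ∈ U ∧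
    ∃ φ : (p ⁻¹' U) ≃ₜ (U × F), ∀ x : p ⁻¹' U, ((φ x).1 : B) = p x

/-- The total space of the pullback of `p : E → B` along `f : B' → B`. -/
abbrev Pullback {E B B' : Type*} (p : E → B) (f : B' → B) : Type _ :=
  {x : B' × E // f x.1 = p x.2}

/-- The projection of the pullback bundle. -/
def pullbackProj {E B B' : Type*} [TopologicalSpace E] [TopologicalSpace B]
    [TopologicalSpace B'] (p : E → B) (f : B' → B) : C(Pullback p f, B') :=
  ⟨fun x => x.1.1, continuous_fst.comp continuous_subtype_val⟩

/-- A continuous map `p : E → B` is `π_q`-surjective up to homotopy if every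
continuous map `S^q → B` is freely homotopic to `p ∘ w` for some continuous
`w : S^q → E`. -/
def PiSurjUpToHomotopy (q : ℕ) {E B : Type*} [TopologicalSpace E]
    [TopologicalSpace B] (p : C(E, B)) : Prop :=
  ∀ u : C(Sph q, B), ∃ w : C(Sph q, E), (p.comp w).Homotopic u

open unitInterval in
/-- The suspension coordinates `(t, x) ↦ (2t - 1, √(1 - (2t-1)²) x)`. -/
noncomputable def suspFun (m : ℕ) (z : I × Sph m) : EuclideanSpace ℝ (Fin (m + 1 + 1)) :=
  WithLp.toLp 2 (Fin.cons (2 * (z.1 : ℝ) - 1)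
    (fun i => Real.sqrt (1 - (2 * (z.1 : ℝ) - 1) ^ 2) * (z.2 : EuclideanSpace ℝ (Fin (m + 1))) i))

theorem sph_sum {m : ℕ} (x : Sph m) :
    ∑ i, ((x : EuclideanSpace ℝ (Fin (m + 1))) i) ^ 2 = 1 := by
  have h : ‖(x : EuclideanSpace ℝ (Fin (m + 1)))‖ = 1 := by simpa using x.2
  have h2 := EuclideanSpace.norm_sq_eq (x : EuclideanSpace ℝ (Fin (m + 1)))
  rw [h] at h2
  simpa using h2.symm

theorem mem_sph_of_sum {m : ℕ} (x : EuclideanSpace ℝ (Fin (m + 1)))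
    (h : ∑ i, (x i) ^ 2 = 1) : x ∈ Metric.sphere (0 : EuclideanSpace ℝ (Fin (m + 1))) 1 := by
  have h2 := EuclideanSpace.norm_sq_eq x
  simp only [Real.norm_eq_abs, sq_abs] at h2
  rw [h] at h2
  have : ‖x‖ = 1 := by nlinarith [norm_nonneg x]
  simpa using this

open unitInterval in
theorem susp_nonneg (t : I) : 0 ≤ 1 - (2 * (t : ℝ) - 1) ^ 2 := by
  have h0 := t.2.1
  have h1 := t.2.2
  nlinarith

open unitInterval in
theorem suspFun_mem (m : ℕ) (z : I × Sph m) :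
    suspFun m z ∈ Metric.sphere (0 : EuclideanSpace ℝ (Fin (m + 1 + 1))) 1 := by
  apply mem_sph_of_sum
  rw [Fin.sum_univ_succ]
  simp only [suspFun, Fin.cons_zero, Fin.cons_succ, mul_pow]
  rw [← Finset.mul_sum, sph_sum, Real.sq_sqrt (susp_nonneg _)]
  ring

open unitInterval in
theorem continuous_suspFun (m : ℕ) : Continuous (suspFun m) := by
  unfold suspFun
  refine (PiLp.continuous_toLp 2 _).comp ?_
  refine continuous_pi fun i => ?_
  refine Fin.cases ?_ (fun j => ?_) i
  · simp only [Fin.cons_zero]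
    fun_prop
  · simp only [Fin.cons_succ]
    fun_prop

open unitInterval in
noncomputable def susp (m : ℕ) : C(I × Sph m, Sph (m + 1)) :=
  ⟨fun z => ⟨suspFun m z, suspFun_mem m z⟩, (continuous_suspFun m).subtype_mk _⟩

theorem sph_nonempty (m : ℕ) : Nonempty (Sph m) :=
  ⟨⟨EuclideanSpace.single 0 1, by simp⟩⟩

open unitInterval in
theorem susp_surjective (m : ℕ) : Function.Surjective (susp m) := by
  intro y
  have hy := sph_sum y
  set a := (y : EuclideanSpace ℝ (Fin (m + 1 + 1))) 0 with ha
  rw [Fin.sum_univ_succ, ← ha] at hy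
  set T := ∑ i : Fin (m + 1), ((y : EuclideanSpace ℝ (Fin (m + 1 + 1))) i.succ) ^ 2 with hT
  have hT0 : 0 ≤ T := Finset.sum_nonneg fun i _ => sq_nonneg _
  have hTa : 1 - a ^ 2 = T := by linarith
  have h1 : -1 ≤ a ∧ a ≤ 1 := by
    constructor <;> nlinarith
  let t : I := ⟨(a + 1) / 2, by constructor <;> linarith [h1.1, h1.2]⟩
  have ht : 2 * (t : ℝ) - 1 = a := by simp only [t]; ring
  by_cases hz : T = 0
  · obtain ⟨x⟩ := sph_nonempty m
    refine ⟨(t, x), Subtype.ext ?_⟩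
    ext i
    refine Fin.cases ?_ (fun j => ?_) i
    · simp [susp, suspFun, ht, ha]
    · have := (Finset.sum_eq_zero_iff_of_nonneg (fun i _ => sq_nonneg _)).1 (hT.symm.trans hz) j
        (Finset.mem_univ j)
      simp only [susp, suspFun, ht, hTa, hz, ContinuousMap.coe_mk, Fin.cons_succ, Real.sqrt_zero,
        zero_mul]
      exact (pow_eq_zero_iff two_ne_zero |>.1 this).symm
  · have hTpos : 0 < T := lt_of_le_of_ne hT0 (Ne.symm hz)
    have hs : Real.sqrt T ≠ 0 := (Real.sqrt_pos.2 hTpos).ne'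
    let x : Sph m := ⟨WithLp.toLp 2 (fun i =>
      (y : EuclideanSpace ℝ (Fin (m + 1 + 1))) i.succ / Real.sqrt T), by
        apply mem_sph_of_sum
        simp only [div_pow]
        rw [← Finset.sum_div, Real.sq_sqrt hT0, ← hT, div_self hz]⟩
    refine ⟨(t, x), Subtype.ext ?_⟩
    ext i
    refine Fin.cases ?_ (fun j => ?_) i
    · simp [susp, suspFun, ht, ha]
    · simp only [susp, suspFun, ht, hTa, x, ContinuousMap.coe_mk, Fin.cons_succ]
      field_simp

open unitInterval in
theorem susp_eq {m : ℕ} {z z' : I × Sph m} (h : susp m z = susp m z') :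
    z = z' ∨ (z.1 = 0 ∧ z'.1 = 0) ∨ (z.1 = 1 ∧ z'.1 = 1) := by
  have h' : suspFun m z = suspFun m z' := congrArg Subtype.val h
  have hi : ∀ i, suspFun m z i = suspFun m z' i := fun i => by rw [h']
  have h0 := hi 0
  simp only [suspFun, Fin.cons_zero] at h0
  have ht : z.1 = z'.1 := Subtype.ext (by linarith)
  by_cases hz : 1 - (2 * (z.1 : ℝ) - 1) ^ 2 = 0
  · right
    have : (z.1 : ℝ) * ((z.1 : ℝ) - 1) = 0 := by nlinarith
    rcases mul_eq_zero.1 this with h | h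
    · left
      have : z.1 = 0 := Subtype.ext h
      exact ⟨this, ht ▸ this⟩
    · right
      have : z.1 = 1 := Subtype.ext (by simpa using sub_eq_zero.1 h)
      exact ⟨this, ht ▸ this⟩
  · left
    refine Prod.ext ht (Subtype.ext ?_)
    ext j
    have hj := hi j.succ
    simp only [suspFun, Fin.cons_succ, ← ht] at hj
    refine mul_left_cancel₀ ?_ hj
    exact (Real.sqrt_pos.2 (lt_of_le_of_ne (susp_nonneg _) (Ne.symm hz))).ne'

open unitInterval in
theorem susp_descend {m : ℕ} {Y : Type*} [TopologicalSpace Y] (g : C(I × Sph m, Y))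
    (h0 : ∀ x y, g (0, x) = g (0, y)) (h1 : ∀ x y, g (1, x) = g (1, y)) :
    ∃ w : C(Sph (m + 1), Y), ∀ z, w (susp m z) = g z := by
  have hq : Topology.IsQuotientMap (susp m) :=
    (susp m).continuous.isClosedMap.isQuotientMap (susp m).continuous (susp_surjective m)
  have hg : ∀ z z', susp m z = susp m z' → g z = g z' := by
    rintro ⟨t, x⟩ ⟨t', x'⟩ h
    rcases susp_eq h with h | ⟨h, h'⟩ | ⟨h, h'⟩
    · rw [h]
    · simp only at h h'
      subst h h'
      exact h0 _ _
    · simp only at h h'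
      subst h h'
      exact h1 _ _
  let w : Sph (m + 1) → Y := fun y => g (Function.surjInv (susp_surjective m) y)
  have hw : ∀ z, w (susp m z) = g z := fun z => hg _ _ (Function.surjInv_eq (susp_surjective m) _)
  refine ⟨⟨w, ?_⟩, hw⟩
  rw [hq.continuous_iff]
  have : w ∘ susp m = g := funext hw
  rw [this]
  exact g.continuous

open unitInterval in
theorem susp_end {m : ℕ} (t : I) (ht : t = 0 ∨ t = 1) (x y : Sph m) :
    susp m (t, x) = susp m (t, y) := by
  apply Subtype.ext
  ext i
  have h : 1 - (2 * (t : ℝ) - 1) ^ 2 = 0 := by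
    rcases ht with rfl | rfl <;> norm_num
  refine Fin.cases ?_ (fun j => ?_) i
  · simp [susp, suspFun]
  · simp [susp, suspFun, h]

theorem one_lt_rank (m : ℕ) (hm : 1 ≤ m) :
    1 < Module.rank ℝ (EuclideanSpace ℝ (Fin (m + 1))) := by
  rw [← Module.finrank_eq_rank]
  simp only [finrank_euclideanSpace, Fintype.card_fin]
  exact_mod_cast (by omega : 1 < m + 1)

open unitInterval in
/-- Lifting of maps from spheres of dimension `≥ 2` through coverings. -/
theorem sphere_lift {B B' : Type*} [TopologicalSpace B] [TopologicalSpace B']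
    (f : C(B', B)) (hf : IsCoveringMap ⇑f) (hfsurj : Function.Surjective ⇑f)
    (m : ℕ) (hm : 1 ≤ m) (u : C(Sph (m + 1), B)) :
    ∃ u' : C(Sph (m + 1), B'), f.comp u' = u := by
  obtain ⟨x0⟩ := sph_nonempty m
  obtain ⟨b, hb⟩ := hfsurj (u (susp m (0, x0)))
  have hpc : PreconnectedSpace (Sph m) :=
    Subtype.preconnectedSpace (isPreconnected_sphere (one_lt_rank m hm) 0 1)
  have H0 : ∀ a, (u.comp (susp m)) (0, a) = f ((ContinuousMap.const (Sph m) b) a) := by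
    intro a
    simp only [ContinuousMap.comp_apply, ContinuousMap.const_apply, hb]
    rw [susp_end 0 (Or.inl rfl) a x0]
  let g := hf.liftHomotopy (u.comp (susp m)) (ContinuousMap.const _ b) H0
  have hg : ∀ z, f (g z) = u (susp m z) := fun z =>
    congrFun (hf.liftHomotopy_lifts (u.comp (susp m)) (ContinuousMap.const _ b) H0) z
  have hg0 : ∀ x, g (0, x) = b := fun x =>
    hf.liftHomotopy_zero (u.comp (susp m)) (ContinuousMap.const _ b) H0 x
  have hg1 : ∀ x y, g (1, x) = g (1, y) := by
    intro x y
    refine hf.const_of_comp (g := fun x => g (1, x)) (by fun_prop) ?_ x y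
    intro a a'
    rw [hg, hg, susp_end 1 (Or.inr rfl) a a']
  obtain ⟨w, hw⟩ := susp_descend g (fun x y => by rw [hg0, hg0]) hg1
  refine ⟨w, ?_⟩
  ext y
  obtain ⟨z, rfl⟩ := susp_surjective m y
  rw [ContinuousMap.comp_apply, hw, hg]

open unitInterval in
/-- Exact path lifting with prescribed end points in bundles with path connected fibres. -/
theorem bundle_path_lift {E B F : Type*} [TopologicalSpace E] [TopologicalSpace B]
    [TopologicalSpace F] [PathConnectedSpace F] (p : C(E, B)) (hp : IsBundleWithFiber F ⇑p)
    (γ : C(I, B)) (e0 e1 : E) (h0 : p e0 = γ 0) (h1 : p e1 = γ 1) :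
    ∃ Γ : C(I, E), (∀ t, p (Γ t) = γ t) ∧ Γ 0 = e0 ∧ Γ 1 = e1 := by
  choose U hUo hUm φ hφ using hp.2
  obtain ⟨t, t_0, t_mono, ⟨n_max, h_max⟩, t_sub⟩ :=
    exists_monotone_Icc_subset_open_cover_unitInterval
    (fun x ↦ (hUo x).preimage γ.continuous) fun t _ ↦ Set.mem_iUnion.2 ⟨γ t, hUm _⟩
  -- local lift
  have loc : ∀ (x : B) (a b : I), a ≤ b → Set.Icc a b ⊆ γ ⁻¹' U x → ∀ e e' : E, p e = γ a →
      p e' = γ b → (a = b → e = e') → ∃ Γ : I → E, ContinuousOn Γ (Set.Icc a b) ∧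
        (∀ s ∈ Set.Icc a b, p (Γ s) = γ s) ∧ Γ a = e ∧ Γ b = e' := by
    intro x a b hab hsub e e' he he' hee
    have hpi : ∀ z, p ((φ x).symm z) = z.1 := fun z => by
      rw [← hφ, Homeomorph.apply_symm_apply]
    rcases hab.eq_or_lt with rfl | hlt
    · refine ⟨fun _ => e, continuousOn_const, fun s hs => ?_, rfl, hee rfl⟩
      rw [Set.Icc_self, Set.mem_singleton_iff] at hs
      rw [hs, he]
    let ee : p ⁻¹' U x := ⟨e, by rw [Set.mem_preimage, he]; exact hsub ⟨le_rfl, hab⟩⟩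
    let ee' : p ⁻¹' U x := ⟨e', by rw [Set.mem_preimage, he']; exact hsub ⟨hab, le_rfl⟩⟩
    let δ : Path (φ x ee).2 (φ x ee').2 := PathConnectedSpace.somePath _ _
    let r : ℝ → ℝ := fun s => (s - a) / (b - a)
    have hab' : (b : ℝ) - a ≠ 0 := by
      have : (a : ℝ) < b := hlt
      linarith
    have hr : Continuous r := by fun_prop
    let G : Set.Icc a b → E := fun s =>
      (φ x).symm (⟨γ s, hsub s.2⟩, δ.extend (r (s : I)))
    have hG : Continuous G := by
      refine continuous_subtype_val.comp ((φ x).symm.continuous.comp ?_)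
      refine Continuous.prodMk ?_ ?_
      · exact (γ.continuous.comp continuous_subtype_val).subtype_mk _
      · exact δ.continuous_extend.comp (hr.comp (continuous_subtype_val.comp continuous_subtype_val))
    refine ⟨Set.IccExtend hab G, (hG.Icc_extend').continuousOn, fun s hs => ?_, ?_, ?_⟩
    · rw [Set.IccExtend_of_mem hab G hs]
      exact hpi _
    · rw [Set.IccExtend_left]
      have : (((⟨γ a, hsub ⟨le_rfl, hab⟩⟩ : U x), δ.extend (r a)) : U x × F) = φ x ee := by
        refine Prod.ext (Subtype.ext ?_) ?_
        · rw [hφ]; exact he.symm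
        · simp [r]
      change (((φ x).symm _ : p ⁻¹' U x) : E) = e
      rw [this, Homeomorph.symm_apply_apply]
    · rw [Set.IccExtend_right]
      have : (((⟨γ b, hsub ⟨hab, le_rfl⟩⟩ : U x), δ.extend (r b)) : U x × F) = φ x ee' := by
        refine Prod.ext (Subtype.ext ?_) ?_
        · rw [hφ]; exact he'.symm
        · simp [r, div_self hab']
      change (((φ x).symm _ : p ⁻¹' U x) : E) = e'
      rw [this, Homeomorph.symm_apply_apply]
  have hsurj : ∀ b : B, ∃ e, p e = b := fun b => by
    obtain ⟨y⟩ := (inferInstance : Nonempty F)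
    refine ⟨(φ b).symm (⟨b, hUm b⟩, y), ?_⟩
    rw [← hφ, Homeomorph.apply_symm_apply]
  suffices ∀ n, ∀ e, p e = γ (t n) → (t n = 0 → e = e0) → ∃ Γ : I → E,
      ContinuousOn Γ (Set.Icc 0 (t n)) ∧
      (∀ s ∈ Set.Icc 0 (t n), p (Γ s) = γ s) ∧ Γ 0 = e0 ∧ Γ (t n) = e by
    have hn := h_max n_max le_rfl
    obtain ⟨Γ, hc, hl, hΓ0, hΓ1⟩ := this n_max e1 (by rw [hn, h1])
      (fun h => by rw [hn] at h; simp at h)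
    have hu : Set.Icc (0 : I) 1 = Set.univ :=
      Set.eq_univ_of_forall fun s => ⟨bot_le, le_top⟩
    rw [hn] at hc hl hΓ1
    rw [hu] at hc hl
    exact ⟨⟨Γ, continuousOn_univ.1 hc⟩, fun s => hl s trivial, hΓ0, hΓ1⟩
  intro n
  induction n with
  | zero =>
    intro e he hee
    refine ⟨fun _ => e0, continuousOn_const, fun s hs => ?_, rfl, (hee t_0).symm⟩
    rw [t_0, Set.Icc_self, Set.mem_singleton_iff] at hs
    rw [hs, h0]
  | succ n ih =>
    intro e he hee
    have hle : t n ≤ t (n + 1) := t_mono n.le_succ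
    obtain ⟨e', he', hee', heq⟩ : ∃ e', p e' = γ (t n) ∧ (t n = 0 → e' = e0) ∧
        (t n = t (n + 1) → e' = e) := by
      by_cases hA : t n = t (n + 1)
      · exact ⟨e, by rw [hA, he], fun h => hee (hA ▸ h), fun _ => rfl⟩
      · by_cases hB : t n = 0
        · exact ⟨e0, by rw [hB, h0], fun _ => rfl, fun h => absurd h hA⟩
        · obtain ⟨e', he'⟩ := hsurj (γ (t n))
          exact ⟨e', he', fun h => absurd h hB, fun h => absurd h hA⟩
    obtain ⟨Γ, hc, hl, hΓ0, hΓ1⟩ := ih e' he' hee'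
    obtain ⟨x, hx⟩ := t_sub n
    obtain ⟨Δ, dc, dl, dΔ0, dΔ1⟩ := loc x _ _ hle hx e' e he' he heq
    have h0n : 0 ≤ t n := bot_le
    have hΘ1 : ∀ s, s ≤ t n → (if s ≤ t n then Γ s else Δ s) = Γ s := fun s hs => if_pos hs
    have hΘ2 : ∀ s, t n ≤ s → (if s ≤ t n then Γ s else Δ s) = Δ s := fun s hs => by
      split_ifs with h
      · rw [le_antisymm h hs, hΓ1, dΔ0]
      · rfl
    refine ⟨fun s => if s ≤ t n then Γ s else Δ s, ?_, fun s hs => ?_, ?_, ?_⟩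
    · rw [← Set.Icc_union_Icc_eq_Icc h0n hle]
      refine ContinuousOn.union_of_isClosed ?_ ?_ isClosed_Icc isClosed_Icc
      · exact hc.congr fun s hs => hΘ1 s hs.2
      · exact dc.congr fun s hs => hΘ2 s hs.1
    · rcases le_total s (t n) with h | h
      · simp only [hΘ1 s h]
        exact hl s ⟨hs.1, h⟩
      · simp only [hΘ2 s h]
        exact dl s ⟨h, hs.2⟩
    · exact (hΘ1 0 h0n).trans hΓ0
    · exact (hΘ2 _ hle).trans dΔ1

theorem sph_zero_discrete : DiscreteTopology (Sph 0) := by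
  have : Finite (Sph 0) := by
    refine Set.Finite.to_subtype ?_
    refine Set.Finite.subset (Set.Finite.image (fun a : ℝ => EuclideanSpace.single (0 : Fin 1) a)
      (Set.toFinite {1, -1})) ?_
    intro x hx
    have h := sph_sum (m := 0) ⟨x, hx⟩
    simp only [Fin.sum_univ_succ, Finset.univ_eq_empty, Finset.sum_empty, add_zero] at h
    refine ⟨x 0, ?_, ?_⟩
    · have h2 : (x 0 - 1) * (x 0 + 1) = 0 := by linear_combination h
      rcases mul_eq_zero.1 h2 with h3 | h3
      · exact Or.inl (by linarith)
      · exact Or.inr (by rw [Set.mem_singleton_iff]; linarith)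
    · ext i
      fin_cases i
      simp
  infer_instance

open unitInterval in
theorem bundle_piOne {E B F : Type*} [TopologicalSpace E] [TopologicalSpace B]
    [TopologicalSpace F] [PathConnectedSpace F] (p : C(E, B)) (hp : IsBundleWithFiber F ⇑p) :
    PiSurjUpToHomotopy 1 p := by
  intro u
  have := sph_zero_discrete
  obtain ⟨x0⟩ := sph_nonempty 0
  have hsurj : ∀ b : B, ∃ e, p e = b := fun b => by
    obtain ⟨U, -, hb, φ, hφ⟩ := hp.2 b
    obtain ⟨y⟩ := (inferInstance : Nonempty F)
    refine ⟨φ.symm (⟨b, hb⟩, y), ?_⟩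
    rw [← hφ, Homeomorph.apply_symm_apply]
  obtain ⟨e0, he0⟩ := hsurj (u (susp 0 (0, x0)))
  obtain ⟨e1, he1⟩ := hsurj (u (susp 0 (1, x0)))
  have key : ∀ x : Sph 0, ∃ Γ : C(I, E), (∀ t, p (Γ t) = u (susp 0 (t, x))) ∧
      Γ 0 = e0 ∧ Γ 1 = e1 := by
    intro x
    refine bundle_path_lift p hp ⟨fun t => u (susp 0 (t, x)), by fun_prop⟩ e0 e1 ?_ ?_
    · simp only [ContinuousMap.coe_mk, he0]
      rw [susp_end 0 (Or.inl rfl) x x0]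
    · simp only [ContinuousMap.coe_mk, he1]
      rw [susp_end 1 (Or.inr rfl) x x0]
  choose Γ hΓ hΓ0 hΓ1 using key
  let g : C(I × Sph 0, E) := ⟨fun z => Γ z.2 z.1,
    continuous_prod_of_discrete_right.2 fun x => (Γ x).continuous⟩
  obtain ⟨w, hw⟩ := susp_descend g (fun x y => by simp [g, hΓ0]) (fun x y => by simp [g, hΓ1])
  refine ⟨w, ?_⟩
  have : p.comp w = u := by
    ext y
    obtain ⟨z, rfl⟩ := susp_surjective 0 y
    rw [ContinuousMap.comp_apply, hw]
    exact hΓ _ _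
  rw [this]

theorem piSurj_pullback {E B B' : Type*} [TopologicalSpace E] [TopologicalSpace B]
    [TopologicalSpace B'] (p : C(E, B)) (f : C(B', B)) (hf : IsCoveringMap ⇑f) (q : ℕ)
    (h : PiSurjUpToHomotopy q p) : PiSurjUpToHomotopy q (pullbackProj ⇑p ⇑f) := by
  intro u'
  obtain ⟨w, hw⟩ := h (f.comp u')
  obtain ⟨H⟩ := hw.symm
  have H0 : ∀ a, H.toContinuousMap (0, a) = f (u' a) := fun a => H.apply_zero a
  let H' := hf.liftHomotopy H.toContinuousMap u' H0
  have hl : ∀ z, f (H' z) = H z := fun z =>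
    congrFun (hf.liftHomotopy_lifts H.toContinuousMap u' H0) z
  have hz : ∀ a, H' (0, a) = u' a := fun a => hf.liftHomotopy_zero H.toContinuousMap u' H0 a
  let W : C(Sph q, Pullback ⇑p ⇑f) := ⟨fun a => ⟨(H' (1, a), w a), by
    simp only [hl]
    exact H.apply_one a⟩, by
      refine Continuous.subtype_mk ?_ _
      fun_prop⟩
  refine ⟨W, ContinuousMap.Homotopic.symm ⟨⟨H', hz, fun a => rfl⟩⟩⟩

theorem piSurj_of_pullback {E B B' : Type*} [TopologicalSpace E] [TopologicalSpace B]
    [TopologicalSpace B'] (p : C(E, B)) (f : C(B', B)) (hf : IsCoveringMap ⇑f)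
    (hfsurj : Function.Surjective ⇑f) (m : ℕ) (hm : 1 ≤ m)
    (h : PiSurjUpToHomotopy (m + 1) (pullbackProj ⇑p ⇑f)) : PiSurjUpToHomotopy (m + 1) p := by
  intro u
  obtain ⟨u', rfl⟩ := sphere_lift f hf hfsurj m hm u
  obtain ⟨w', hw'⟩ := h u'
  let w : C(Sph (m + 1), E) := ⟨fun a => (w' a).1.2, by fun_prop⟩
  refine ⟨w, ?_⟩
  have : p.comp w = f.comp ((pullbackProj ⇑p ⇑f).comp w') := by
    ext a
    exact (w' a).2.symm
  rw [this]
  exact ContinuousMap.Homotopic.comp (.refl f) hw'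

/-- Let `k ≥ 2`, let `p : E → B` be a fiber bundle with fiber `S^{k-1}` over a
nonempty connected topological manifold `B`, and let `f : B' → B` be a
surjective covering map from a nonempty topological manifold `B'`. Then `p`
fails `π_q`-surjectivity up to homotopy for some `q ≥ 1` if and only if the
pullback projection `f*E → B'` does. -/
theorem stmt_6 (k n n' : ℕ) (hk : 2 ≤ k)
    {E B B' : Type*} [TopologicalSpace E] [TopologicalSpace B] [TopologicalSpace B']
    [Nonempty B] [ConnectedSpace B] [T2Space B] [SecondCountableTopology B]
    [ChartedSpace (EuclideanSpace ℝ (Fin n)) B]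
    [Nonempty B'] [T2Space B'] [SecondCountableTopology B']
    [ChartedSpace (EuclideanSpace ℝ (Fin n')) B']
    (p : C(E, B)) (hp : IsBundleWithFiber (Sph (k - 1)) ⇑p)
    (f : C(B', B)) (hf : IsCoveringMap ⇑f) (hfsurj : Function.Surjective ⇑f) :
    (∃ q : ℕ, 1 ≤ q ∧ ¬ PiSurjUpToHomotopy q p) ↔
      (∃ q : ℕ, 1 ≤ q ∧ ¬ PiSurjUpToHomotopy q (pullbackProj ⇑p ⇑f)) := by
  constructor
  · rintro ⟨q, hq, hn⟩
    refine ⟨q, hq, fun h => hn ?_⟩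
    have : PathConnectedSpace (Sph (k - 1)) :=
      isPathConnected_iff_pathConnectedSpace.1
        (isPathConnected_sphere (one_lt_rank (k - 1) (by omega)) 0 zero_le_one)
    rcases hq.eq_or_lt with rfl | hq
    · exact bundle_piOne p hp
    · obtain ⟨m, rfl⟩ : ∃ m, q = m + 1 := ⟨q - 1, by omega⟩
      exact piSurj_of_pullback p f hf hfsurj m (by omega) h
  · rintro ⟨q, hq, hn⟩
    exact ⟨q, hq, fun h => hn (piSurj_pullback p f hf q h)⟩
end

section
/- Let k ≥ 3 and m ≥ 1 be natural numbers, let B and B′ be nonempty connected topological manifolds, let p : E → B be the projection of a fiber bundle with fiber the sphere S^{k−1}, let f : B′ → B be the projection of a fiber bundle with fiber the m-dimensional torus (the product of m copies of the circle S¹), and let p′ : f*E → B′ be the projection of the pullback bundle. Then there exists q ≥ 1 such that p is not π_q-surjective up to homotopy if and only if there exists q ≥ 1 such that p′ is not π_q-surjective up to homotopy. -/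
open Set

/-- The `m`-dimensional torus, the product of `m` copies of the circle `S¹`. -/
abbrev Torus (m : ℕ) : Type := Fin m → Sph 1

open Set Topology

/-- Local transport along a map: the part of local triviality used for lifting. -/
def HasTransport {E B : Type*} [TopologicalSpace E] [TopologicalSpace B] (p : E → B) : Prop :=
  ∀ b : B, ∃ U : Set B, IsOpen U ∧ b ∈ U ∧ ∃ T : U × (p ⁻¹' U) → E, Continuous T ∧
    (∀ x, p (T x) = x.1) ∧ ∀ e : p ⁻¹' U, T (⟨p e, e.2⟩, e) = e

theorem hasTransport_of_bundle {E B F : Type*} [TopologicalSpace E] [TopologicalSpace B]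
    [TopologicalSpace F] {p : E → B} (hp : IsBundleWithFiber F p) : HasTransport p := by
  intro b
  obtain ⟨U, hU, hb, φ, hφ⟩ := hp.2 b
  refine ⟨U, hU, hb, fun x => (φ.symm (x.1, (φ x.2).2)).1, by fun_prop, ?_, ?_⟩
  · intro x
    have := hφ (φ.symm (x.1, (φ x.2).2))
    rw [← this]; simp
  · intro e
    have : ((⟨p e, e.2⟩ : U), (φ e).2) = φ e := by
      ext
      · exact (hφ e).symm
      · rfl
    simp only [this]; simp

theorem modify_lift {Y E B : Type*} [TopologicalSpace Y] [TopologicalSpace E] [TopologicalSpace B]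
    {p : C(E, B)} {U : Set B} {T : U × (p ⁻¹' U) → E} (hT : Continuous T)
    (hT1 : ∀ x, p (T x) = x.1) (hT2 : ∀ e : p ⁻¹' U, T (⟨p e, e.2⟩, e) = e)
    (g g' : C(Y, B)) {N K : Set Y} (hN : IsOpen N) (hK : IsClosed K) (hKN : K ⊆ N)
    (hgg : ∀ y, y ∉ K → g y = g' y) (hg : ∀ y ∈ N, g y ∈ U) (hg' : ∀ y ∈ N, g' y ∈ U)
    (hl : ∃ G : C(Y, E), p.comp G = g) : ∃ G : C(Y, E), p.comp G = g' := by
  classical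
  obtain ⟨G, hG⟩ := hl
  have hGy : ∀ y, p (G y) = g y := fun y => congrArg (fun h => h y) hG
  have hm : ∀ y ∈ N, G y ∈ p ⁻¹' U := fun y hy => by
    rw [mem_preimage, hGy]; exact hg y hy
  let G' : Y → E := fun y =>
    if h : y ∈ N then T (⟨g' y, hg' y h⟩, ⟨G y, hm y h⟩) else G y
  have hoff : ∀ y, y ∉ K → G' y = G y := by
    intro y hy
    by_cases h : y ∈ N
    · simp only [G', h, dif_pos]
      have h2 := hT2 ⟨G y, hm y h⟩
      refine Eq.trans ?_ h2
      congr 2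
      ext
      simp [hGy, hgg y hy]
    · simp [G', h]
  have hc : Continuous G' := by
    rw [continuous_iff_continuousAt]
    intro y
    by_cases h : y ∈ N
    · have : ContinuousOn G' N := by
        rw [continuousOn_iff_continuous_domRestrict]
        have : N.domRestrict G' = fun y : N => T (⟨g' y, hg' y y.2⟩, ⟨G y, hm y y.2⟩) := by
          ext y
          simp [G']
        rw [this]
        fun_prop
      exact this.continuousAt (hN.mem_nhds h)
    · have : G =ᶠ[𝓝 y] G' := by
        filter_upwards [hK.isOpen_compl.mem_nhds (fun h' => h (hKN h'))] with z hz
        exact (hoff z hz).symm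
      exact G.continuous.continuousAt.congr this
  refine ⟨⟨G', hc⟩, ?_⟩
  ext y
  by_cases h : y ∈ N
  · simp [G', h, hT1]
  · have h' : y ∉ K := fun h' => h (hKN h')
    simp [hoff y h', hGy, hgg y h']

theorem lift_local {Y E B : Type*} [TopologicalSpace Y] [CompactSpace Y] [T2Space Y]
    [TopologicalSpace E] [TopologicalSpace B]
    {p : C(E, B)} (hp : HasTransport p) (H : C(ℝ × Y, B)) (t₀ : ℝ) :
    ∃ δ > 0, ∀ s ∈ Metric.ball t₀ δ, ∀ τ : C(Y, ℝ), (∀ y, τ y ∈ Metric.ball t₀ δ) →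
      (∃ G : C(Y, E), ∀ y, p (G y) = H (τ y, y)) → ∃ G : C(Y, E), ∀ y, p (G y) = H (s, y) := by
  have key : ∃ δ > 0, ∀ s ∈ Metric.ball t₀ δ, ∀ τ : C(Y, ℝ), (∀ y, τ y ∈ Metric.ball t₀ δ) →
      (∃ G : C(Y, E), ∀ y, p (G y) = H (τ y, y)) →
      ∃ τ' : C(Y, ℝ), (∀ y, τ' y ∈ Metric.ball t₀ δ) ∧
       (∃ G : C(Y, E), ∀ y, p (G y) = H (τ' y, y)) ∧ (∀ y, τ y = s → τ' y = s) ∧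
       ∀ y ∈ (univ : Set Y), τ' y = s := by
    have key2 : ∃ δ₀ > 0, ∀ δ, 0 < δ → δ ≤ δ₀ → ∀ s ∈ Metric.ball t₀ δ, ∀ τ : C(Y, ℝ),
        (∀ y, τ y ∈ Metric.ball t₀ δ) →
        (∃ G : C(Y, E), ∀ y, p (G y) = H (τ y, y)) →
        ∃ τ' : C(Y, ℝ), (∀ y, τ' y ∈ Metric.ball t₀ δ) ∧
         (∃ G : C(Y, E), ∀ y, p (G y) = H (τ' y, y)) ∧ (∀ y, τ y = s → τ' y = s) ∧
         ∀ y ∈ (univ : Set Y), τ' y = s := by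
      refine (isCompact_univ (X := Y)).induction_on (p := fun S => ∃ δ₀ > 0, ∀ δ, 0 < δ → δ ≤ δ₀ →
        ∀ s ∈ Metric.ball t₀ δ, ∀ τ : C(Y, ℝ),
        (∀ y, τ y ∈ Metric.ball t₀ δ) →
        (∃ G : C(Y, E), ∀ y, p (G y) = H (τ y, y)) →
        ∃ τ' : C(Y, ℝ), (∀ y, τ' y ∈ Metric.ball t₀ δ) ∧
         (∃ G : C(Y, E), ∀ y, p (G y) = H (τ' y, y)) ∧ (∀ y, τ y = s → τ' y = s) ∧
         ∀ y ∈ S, τ' y = s) ?_ ?_ ?_ ?_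
      · exact ⟨1, one_pos, fun δ _ _ s hs τ h1 h2 => ⟨τ, h1, h2, fun _ h => h, by simp⟩⟩
      · rintro S S' hSS ⟨δ₀, h0, h⟩
        refine ⟨δ₀, h0, fun δ hδ hle s hs τ h1 h2 => ?_⟩
        obtain ⟨τ', a, b, c, d⟩ := h δ hδ hle s hs τ h1 h2
        exact ⟨τ', a, b, c, fun y hy => d y (hSS hy)⟩
      · rintro S S' ⟨δ₀, h0, h⟩ ⟨δ₁, h0', h'⟩
        refine ⟨min δ₀ δ₁, lt_min h0 h0', fun δ hδ hle s hs τ h1 h2 => ?_⟩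
        obtain ⟨τ', a, b, c, d⟩ := h δ hδ (hle.trans (min_le_left _ _)) s hs τ h1 h2
        obtain ⟨τ₂, a', b', c', d'⟩ := h' δ hδ (hle.trans (min_le_right _ _)) s hs τ' a b
        refine ⟨τ₂, a', b', fun y hy => c' y (c y hy), ?_⟩
        rintro y (hy | hy)
        · exact c' y (d y hy)
        · exact d' y hy
      · intro y₀ _
        obtain ⟨U, hU, hb, T, hT, hT1, hT2⟩ := hp (H (t₀, y₀))
        have hnh : H ⁻¹' U ∈ 𝓝 (t₀, y₀) := (hU.preimage H.continuous).mem_nhds hb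
        rw [nhds_prod_eq, Filter.mem_prod_iff] at hnh
        obtain ⟨V, hV, W, hW, hVW⟩ := hnh
        obtain ⟨δ₀, hδ₀, hball⟩ := Metric.mem_nhds_iff.1 hV
        obtain ⟨N, hNW, hNo, hyN⟩ := mem_nhds_iff.1 hW
        obtain ⟨K, hKn, hKc, hKN⟩ := exists_mem_nhds_isClosed_subset (hNo.mem_nhds hyN)
        obtain ⟨S, hSn, hSc, hSK⟩ := exists_mem_nhds_isClosed_subset
          (isOpen_interior.mem_nhds (mem_interior_iff_mem_nhds.2 hKn))
        have hdis : Disjoint (interior K)ᶜ S := by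
          rw [Set.disjoint_left]
          intro x hx hx'
          exact hx (hSK hx')
        obtain ⟨ρ, hρ0, hρ1, hρ⟩ := exists_continuous_zero_one_of_isClosed
          isOpen_interior.isClosed_compl hSc hdis
        refine ⟨S, mem_nhdsWithin_of_mem_nhds hSn, δ₀, hδ₀, fun δ hδ hle s hs τ h1 h2 => ?_⟩
        let τ' : C(Y, ℝ) := ⟨fun y => (1 - ρ y) * τ y + ρ y * s, by fun_prop⟩
        have hτ' : ∀ y, τ' y ∈ Metric.ball t₀ δ := fun y =>
          convex_ball t₀ δ (h1 y) hs (by linarith [(hρ y).2]) (hρ y).1 (by ring)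
        refine ⟨τ', hτ', ?_, ?_, ?_⟩
        · obtain ⟨G, hG⟩ := h2
          obtain ⟨G', hG'⟩ := modify_lift hT hT1 hT2
            (⟨fun y => H (τ y, y), by fun_prop⟩ : C(Y, B)) (⟨fun y => H (τ' y, y), by fun_prop⟩)
            hNo hKc hKN (by
              intro y hy
              have : ρ y = 0 := hρ0 (fun h => hy (interior_subset h))
              simp [τ', this]) (fun y hy => hVW ⟨hball (Metric.ball_subset_ball hle (h1 y)), hNW hy⟩)
            (fun y hy => hVW ⟨hball (Metric.ball_subset_ball hle (hτ' y)), hNW hy⟩)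
            ⟨G, by ext y; exact hG y⟩
          exact ⟨G', fun y => congrArg (fun h => h y) hG'⟩
        · intro y hy
          simp [τ', hy]; ring
        · intro y hy
          have : ρ y = 1 := hρ1 hy
          simp [τ', this]
    obtain ⟨δ, h0, h⟩ := key2
    exact ⟨δ, h0, h δ h0 le_rfl⟩
  obtain ⟨δ, h0, h⟩ := key
  refine ⟨δ, h0, fun s hs τ h1 h2 => ?_⟩
  obtain ⟨τ', -, ⟨G, hG⟩, -, h3⟩ := h s hs τ h1 h2
  exact ⟨G, fun y => by rw [hG, h3 y (mem_univ _)]⟩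

theorem lift_of_homotopic {Y E B : Type*} [TopologicalSpace Y] [CompactSpace Y] [T2Space Y]
    [TopologicalSpace E] [TopologicalSpace B]
    {p : C(E, B)} (hp : HasTransport p) {g₀ g₁ : C(Y, B)} (hg : g₀.Homotopic g₁)
    (hl : ∃ G : C(Y, E), p.comp G = g₀) : ∃ G : C(Y, E), p.comp G = g₁ := by
  obtain ⟨H⟩ := hg
  let H' : C(ℝ × Y, B) := ⟨fun x => H (projIcc 0 1 zero_le_one x.1, x.2), by
    have := continuous_projIcc (a := (0:ℝ)) (b := 1) (h := zero_le_one)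
    fun_prop⟩
  let A : Set ℝ := {t | ∃ G : C(Y, E), ∀ y, p (G y) = H' (t, y)}
  have hloc : ∀ t₀, ∃ δ > 0, ∀ s ∈ Metric.ball t₀ δ, ∀ t ∈ Metric.ball t₀ δ, s ∈ A → t ∈ A := by
    intro t₀
    obtain ⟨δ, h0, h⟩ := lift_local hp H' t₀
    exact ⟨δ, h0, fun s hs t ht hsA => h t ht (ContinuousMap.const Y s) (fun _ => hs) hsA⟩
  have hcl : IsClopen A := by
    constructor
    · rw [← isOpen_compl_iff, Metric.isOpen_iff]
      intro t₀ ht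
      obtain ⟨δ, h0, h⟩ := hloc t₀
      exact ⟨δ, h0, fun s hs hsA => ht (h s hs t₀ (Metric.mem_ball_self h0) hsA)⟩
    · rw [Metric.isOpen_iff]
      intro t₀ ht
      obtain ⟨δ, h0, h⟩ := hloc t₀
      exact ⟨δ, h0, fun s hs => h t₀ (Metric.mem_ball_self h0) s hs ht⟩
  have h0 : (0 : ℝ) ∈ A := by
    obtain ⟨G, hG⟩ := hl
    refine ⟨G, fun y => ?_⟩
    have : p (G y) = g₀ y := congrArg (fun h => h y) hG
    simp [H', this]
  have h1 : (1 : ℝ) ∈ A := by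
    rcases isClopen_iff.1 hcl with h | h
    · rw [h] at h0; exact h0.elim
    · rw [h]; trivial
  obtain ⟨G, hG⟩ := h1
  refine ⟨G, ?_⟩
  ext y
  simpa [H'] using hG y

/-- Maps from the unit sphere of `ℝ^q` to `F` extend over `ℝ^q`. -/
def SphExt (q : ℕ) (F : Type*) [TopologicalSpace F] : Prop :=
  ∀ g : C(Metric.sphere (0 : EuclideanSpace ℝ (Fin q)) 1, F),
    ∃ G : C(EuclideanSpace ℝ (Fin q), F), ∀ x, G x.1 = g x

theorem sphExt_homeo {q : ℕ} {F F' : Type*} [TopologicalSpace F] [TopologicalSpace F']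
    (h : F ≃ₜ F') (hF : SphExt q F) : SphExt q F' := by
  intro g
  obtain ⟨G, hG⟩ := hF ((h.symm : C(F', F)).comp g)
  exact ⟨(h : C(F, F')).comp G, fun x => by simp [hG]⟩

theorem sph_homotopic {X : Type*} [TopologicalSpace X] {q : ℕ} (a b : C(X, Sph q))
    (h : ∀ x, (a x).1 ≠ - (b x).1) : a.Homotopic b := by
  have hne : ∀ z : unitInterval × X, (1 - (z.1 : ℝ)) • (a z.2).1 + (z.1 : ℝ) • (b z.2).1 ≠ 0 := by
    rintro ⟨⟨s, h0, h1⟩, x⟩ hz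
    simp only at hz
    have e1 : (1 - s) • (a x).1 = - (s • (b x).1) := eq_neg_of_add_eq_zero_left hz
    have e2 := congrArg norm e1
    have na : ‖(a x).1‖ = 1 := by simp
    have nb : ‖(b x).1‖ = 1 := by simp
    rw [norm_neg, norm_smul, norm_smul, na, nb, Real.norm_of_nonneg h0,
      Real.norm_of_nonneg (by linarith)] at e2
    have hs : s = 1 / 2 := by linarith
    subst hs
    apply h x
    have e3 := congrArg (fun v => (2 : ℝ) • v) e1
    simp only [smul_neg, smul_smul] at e3
    norm_num at e3
    exact e3
  refine ⟨⟨⟨fun z => ⟨(‖(1 - (z.1 : ℝ)) • (a z.2).1 + (z.1 : ℝ) • (b z.2).1‖)⁻¹ •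
    ((1 - (z.1 : ℝ)) • (a z.2).1 + (z.1 : ℝ) • (b z.2).1), ?_⟩, ?_⟩, ?_, ?_⟩⟩
  · rw [mem_sphere_zero_iff_norm, norm_smul, norm_inv, norm_norm,
      inv_mul_cancel₀ (norm_ne_zero_iff.2 (hne z))]
  · have hc : Continuous (fun z : unitInterval × X =>
        (1 - (z.1 : ℝ)) • (a z.2).1 + (z.1 : ℝ) • (b z.2).1) := by fun_prop
    exact Continuous.subtype_mk
      ((hc.norm.inv₀ fun z => norm_ne_zero_iff.2 (hne z)).smul hc) _
  · intro x; ext; simp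
  · intro x; ext; simp

theorem sphExt_sphere {q n : ℕ} (hqn : q ≤ n) : SphExt q (Sph n) := by
  intro g
  have : TietzeExtension.{0, 0} (EuclideanSpace ℝ (Fin (n + 1))) := TietzeExtension.of_tvs ℝ
  obtain ⟨gh, hgh⟩ := ContinuousMap.exists_restrict_eq (Metric.isClosed_sphere)
    (⟨fun x => (g x).1, by fun_prop⟩ :
      C(Metric.sphere (0 : EuclideanSpace ℝ (Fin q)) 1, EuclideanSpace ℝ (Fin (n + 1))))
  have hgx : ∀ x : Metric.sphere (0 : EuclideanSpace ℝ (Fin q)) 1, gh x.1 = (g x).1 :=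
    fun x => congrArg (fun h => h x) hgh
  obtain ⟨S, hS, hSd, -⟩ := gh.continuous.exists_contDiff_approx 1
    (continuous_const (y := (1 / 4 : ℝ))) (fun _ => by norm_num)
  have hd := (show ContDiff ℝ 1 S from hS).dense_compl_range_of_finrank_lt_finrank
    (by simp; omega)
  obtain ⟨v, hv, hvd⟩ := hd.exists_dist_lt 0 (show (0 : ℝ) < 1 / 4 by norm_num)
  have hSc : Continuous S := hS.continuous
  rw [dist_zero_left] at hvd
  have hSv : ∀ x, S x - v ≠ 0 := fun x h => hv ⟨x, sub_eq_zero.1 h⟩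
  have hclose : ∀ x, ‖(S x - v) - gh x‖ < 1 / 2 := by
    intro x
    have h1 := hSd x
    rw [dist_eq_norm] at h1
    calc ‖(S x - v) - gh x‖ = ‖(S x - gh x) - v‖ := by congr 1; abel
      _ ≤ ‖S x - gh x‖ + ‖v‖ := norm_sub_le _ _
      _ < 1 / 2 := by linarith
  let lam : EuclideanSpace ℝ (Fin q) → ℝ := fun x => max 0 (min 1 (2 * ‖gh x‖ - 1))
  have hlam : Continuous lam := by fun_prop
  let Ψ : EuclideanSpace ℝ (Fin q) → EuclideanSpace ℝ (Fin (n + 1)) :=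
    fun x => gh x + (1 - lam x) • ((S x - v) - gh x)
  have hΨc : Continuous Ψ := by fun_prop
  have hΨ : ∀ x, Ψ x ≠ 0 := by
    intro x hx
    have hl1 : lam x ≤ 1 := max_le zero_le_one (min_le_left _ _)
    have hl0 : 0 ≤ lam x := le_max_left _ _
    by_cases h : ‖gh x‖ ≤ 1 / 2
    · have : lam x = 0 := max_eq_left ((min_le_right _ _).trans (by linarith))
      apply hSv x
      simpa [Ψ, this] using hx
    · have e1 : gh x = - ((1 - lam x) • ((S x - v) - gh x)) := eq_neg_of_add_eq_zero_left hx
      have e2 := congrArg norm e1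
      rw [norm_neg, norm_smul, Real.norm_of_nonneg (by linarith)] at e2
      have := hclose x
      have h3 := norm_nonneg ((S x - v) - gh x)
      nlinarith
  have hmem : ∀ x, ‖Ψ x‖⁻¹ • Ψ x ∈ Metric.sphere (0 : EuclideanSpace ℝ (Fin (n + 1))) 1 := by
    intro x
    rw [mem_sphere_zero_iff_norm, norm_smul, norm_inv, norm_norm,
      inv_mul_cancel₀ (norm_ne_zero_iff.2 (hΨ x))]
  have hcont : Continuous fun x => ‖Ψ x‖⁻¹ • Ψ x :=
    (hΨc.norm.inv₀ fun z => norm_ne_zero_iff.2 (hΨ z)).smul hΨc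
  refine ⟨⟨fun x => ⟨‖Ψ x‖⁻¹ • Ψ x, hmem x⟩, hcont.subtype_mk hmem⟩, ?_⟩
  · intro x
    have hn : ‖gh x.1‖ = 1 := by rw [hgx]; simp
    have hl : lam x.1 = 1 := by simp only [lam, hn]; norm_num
    have hP : Ψ x.1 = (g x).1 := by simp [Ψ, hl, hgx]
    ext1
    simp [hP]

theorem sphExt_discrete {q : ℕ} (hq : 2 ≤ q) (F : Type*) [TopologicalSpace F]
    [DiscreteTopology F] : SphExt q F := by
  intro g
  have hr : 1 < Module.rank ℝ (EuclideanSpace ℝ (Fin q)) := by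
    rw [← Module.finrank_eq_rank]
    have : (1 : ℕ) < Module.finrank ℝ (EuclideanSpace ℝ (Fin q)) := by simp; omega
    exact_mod_cast this
  have hc := isConnected_sphere hr (0 : EuclideanSpace ℝ (Fin q)) zero_le_one
  have : ConnectedSpace (Metric.sphere (0 : EuclideanSpace ℝ (Fin q)) 1) :=
    isConnected_iff_connectedSpace.1 hc
  obtain ⟨x₀⟩ := (inferInstance : Nonempty (Metric.sphere (0 : EuclideanSpace ℝ (Fin q)) 1))
  exact ⟨ContinuousMap.const _ (g x₀), fun x =>
    PreconnectedSpace.constant inferInstance g.continuous⟩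

/-- Every map from the sphere lifts through a locally trivial map with good fibers. -/
theorem sphere_lift_s7 {q : ℕ} {E B : Type*} [TopologicalSpace E] [TopologicalSpace B]
    {p : C(E, B)} (hp : HasTransport p) (hs : Function.Surjective p)
    (hext : ∀ b, SphExt q (p ⁻¹' {b})) (u : C(Sph q, B)) : ∃ w : C(Sph q, E), p.comp w = u := by
  classical
  let e : EuclideanSpace ℝ (Fin (q + 1)) := EuclideanSpace.single 0 1
  have hen : ‖e‖ = 1 := by simp [e]
  have he0 : e 0 = 1 := by simp [e]
  have hin : ∀ y : EuclideanSpace ℝ (Fin (q + 1)), inner ℝ y e = y 0 := by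
    intro y; simp [e, EuclideanSpace.inner_single_right]
  let c : C(Sph q, Sph q) := ⟨fun y => ⟨(2 * max (y.1 0) 0) • y.1 - e, by
    rw [mem_sphere_zero_iff_norm, ← sq_eq_sq₀ (norm_nonneg _) zero_le_one, norm_sub_sq_real,
      inner_smul_left, hin, norm_smul, hen]
    have : ‖y.1‖ = 1 := by simp
    rw [this]
    rcases le_total (y.1 0) 0 with h | h
    · simp [max_eq_right h]
    · simp [max_eq_left h, abs_of_nonneg h]; ring⟩, by fun_prop⟩
  have hcid : c.Homotopic (ContinuousMap.id _) := by
    apply sph_homotopic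
    intro y hy
    have hn : ‖y.1‖ = 1 := by simp
    have e1 : (2 * max (y.1 0) 0 + 1) • y.1 = e := by
      have : (2 * max (y.1 0) 0) • y.1 - e = - y.1 := hy
      rw [add_smul, one_smul, sub_eq_iff_eq_add.1 this]; abel
    have hm : 0 ≤ max (y.1 0) 0 := le_max_right _ _
    have e2 := congrArg norm e1
    rw [norm_smul, hn, hen, Real.norm_of_nonneg (by linarith)] at e2
    have e3 : max (y.1 0) 0 = 0 := by linarith
    rw [e3] at e1
    have e4 : y.1 = e := by simpa using e1
    rw [e4, he0] at e3
    norm_num at e3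
  refine lift_of_homotopic hp (g₀ := u.comp c) (g₁ := u)
    (by simpa using ContinuousMap.Homotopic.comp (ContinuousMap.Homotopic.refl u) hcid) ?_
  let D : Set (Sph q) := {y | 0 ≤ y.1 0}
  have hDc : IsClosed D := isClosed_le continuous_const (by fun_prop)
  have : CompactSpace D := isCompact_iff_compactSpace.1 hDc.isCompact
  let ι : C(D, Sph q) := ⟨Subtype.val, continuous_subtype_val⟩
  let ep : Sph q := ⟨e, by simp [hen]⟩
  have hι : (ContinuousMap.const D ep).Homotopic ι := by
    apply sph_homotopic
    intro y hy
    have h1 : e 0 = - (y.1.1 0) := by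
      have : e = - y.1.1 := hy
      rw [this]; simp
    have h2 : 0 ≤ y.1.1 0 := y.2
    linarith
  obtain ⟨L, hL⟩ : ∃ L : C(D, E), p.comp L = (u.comp c).comp ι := by
    refine lift_of_homotopic hp (g₀ := (u.comp c).comp (ContinuousMap.const D ep))
      (ContinuousMap.Homotopic.comp (ContinuousMap.Homotopic.refl _) hι) ?_
    obtain ⟨x, hx⟩ := hs (u (c ep))
    exact ⟨ContinuousMap.const D x, by ext y; simpa using hx⟩
  have hLy : ∀ y : D, p (L y) = u (c y.1) := fun y => congrArg (fun h => h y) hL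
  let em : Sph q := ⟨-e, by simp [hen]⟩
  have hclow : ∀ y : Sph q, y.1 0 ≤ 0 → c y = em := by
    intro y hy
    ext1
    simp [c, em, max_eq_right hy]
  -- equator inclusion
  let eq : C(Metric.sphere (0 : EuclideanSpace ℝ (Fin q)) 1, D) :=
    ⟨fun x => ⟨⟨WithLp.toLp 2 (Fin.cons 0 (fun i => x.1 i)), by
      have : ‖x.1‖ = 1 := by simp
      rw [EuclideanSpace.norm_eq] at this
      rw [mem_sphere_zero_iff_norm, EuclideanSpace.norm_eq, Fin.sum_univ_succ]
      simpa using this⟩, by simp [D]⟩, by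
      refine Continuous.subtype_mk (Continuous.subtype_mk ?_ _) _
      refine (PiLp.continuous_toLp 2 _).comp ?_
      refine continuous_pi fun i => ?_
      refine Fin.cases ?_ (fun j => ?_) i
      · simpa using continuous_const
      · simp only [Fin.cons_succ]; fun_prop⟩
  obtain ⟨M, hM⟩ := hext (u em) ⟨fun x => ⟨L (eq x), by
    rw [mem_preimage, hLy, hclow _ (by simp [eq])]; rfl⟩, by fun_prop⟩
  let tl : Sph q → EuclideanSpace ℝ (Fin q) := fun y => WithLp.toLp 2 (fun i => y.1 i.succ)
  have htl : Continuous tl := by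
    refine (PiLp.continuous_toLp 2 _).comp ?_
    fun_prop
  have hagree : ∀ y : Sph q, ∀ h : y.1 0 = 0, L ⟨y, h.ge⟩ = (M (tl y)).1 := by
    intro y h
    have ht : ‖tl y‖ = 1 := by
      have : ‖y.1‖ = 1 := by simp
      rw [EuclideanSpace.norm_eq, Fin.sum_univ_succ] at this
      rw [EuclideanSpace.norm_eq]
      simpa [h, tl] using this
    have := hM ⟨tl y, by simp [ht]⟩
    simp only at this
    rw [this]
    simp only [ContinuousMap.coe_mk]
    congr 1
    ext i
    refine Fin.cases ?_ (fun j => ?_) i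
    · simp [eq, h]
    · simp [eq, tl]
  let w : Sph q → E := fun y => if h : 0 ≤ y.1 0 then L ⟨y, h⟩ else (M (tl y)).1
  have hw1 : ∀ y (h : 0 ≤ y.1 0), w y = L ⟨y, h⟩ := fun y h => by simp [w, h]
  have hw2 : ∀ y : Sph q, y.1 0 ≤ 0 → w y = (M (tl y)).1 := by
    intro y h
    by_cases h' : 0 ≤ y.1 0
    · rw [hw1 y h', hagree y (le_antisymm h h')]
    · simp [w, h']
  have hwc : Continuous w := by
    have hD2 : IsClosed {y : Sph q | y.1 0 ≤ 0} := isClosed_le (by fun_prop) continuous_const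
    have c1 : ContinuousOn w D := by
      rw [continuousOn_iff_continuous_domRestrict]
      refine L.continuous.congr fun y => ?_
      exact (hw1 y.1 y.2).symm
    have c2 : ContinuousOn w {y : Sph q | y.1 0 ≤ 0} := by
      refine ContinuousOn.congr (f := fun y => (M (tl y)).1) ?_ hw2
      exact (by fun_prop : Continuous fun y => (M (tl y)).1).continuousOn
    rw [← continuousOn_univ]
    refine (c1.union_of_isClosed c2 hDc hD2).mono fun y _ => ?_
    exact le_total 0 (y.1 0)
  refine ⟨⟨w, hwc⟩, ?_⟩
  ext y
  rcases le_total 0 (y.1 0) with h | h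
  · simp [hw1 y h, hLy]
  · simp only [ContinuousMap.comp_apply, ContinuousMap.coe_mk, hw2 y h, hclow y h]
    exact (M (tl y)).2

theorem bundle_fiber_homeo {E B F : Type*} [TopologicalSpace E] [TopologicalSpace B]
    [TopologicalSpace F] {p : E → B} (hp : IsBundleWithFiber F p) (b : B) :
    Nonempty (F ≃ₜ p ⁻¹' {b}) := by
  obtain ⟨U, hU, hb, φ, hφ⟩ := hp.2 b
  exact ⟨
  { toFun i := ⟨φ.symm (⟨b, hb⟩, i), by simp [← hφ]⟩
    invFun e := (φ ⟨e, by rwa [Set.mem_preimage, (e.2 : p e = b)]⟩).2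
    left_inv _ := by simp
    right_inv e := Set.inclusion_injective (Set.preimage_mono (Set.singleton_subset_iff.mpr hb)) <|
      φ.injective <| Prod.ext (Subtype.ext <| by simpa [hφ] using e.2.symm) (by simp)
    continuous_toFun := by fun_prop
    continuous_invFun := by fun_prop }⟩

theorem bundle_sphere_lift {q : ℕ} {E B F : Type*} [TopologicalSpace E] [TopologicalSpace B]
    [TopologicalSpace F] [Nonempty F] {p : C(E, B)} (hp : IsBundleWithFiber F p)
    (hF : SphExt q F) (u : C(Sph q, B)) : ∃ w : C(Sph q, E), p.comp w = u := by
  refine sphere_lift_s7 (hasTransport_of_bundle hp) ?_ ?_ u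
  · intro b
    obtain ⟨h⟩ := bundle_fiber_homeo hp b
    exact ⟨_, (h (Classical.arbitrary F)).2⟩
  · intro b
    obtain ⟨h⟩ := bundle_fiber_homeo hp b
    exact sphExt_homeo h hF

theorem sphExt_circle {q : ℕ} (hq : 3 ≤ q) : SphExt q Circle := by
  obtain ⟨r, rfl⟩ : ∃ r, q = r + 1 := ⟨q - 1, by omega⟩
  intro g
  obtain ⟨w, hw⟩ := sphere_lift_s7 (q := r) (p := Circle.exp) (by
      intro b
      obtain ⟨-, U, hb, hU, -, φ, hφ⟩ := Circle.isCoveringMap_exp b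
      refine ⟨U, hU, hb, fun x => (φ.symm (x.1, (φ x.2).2)).1, by fun_prop, ?_, ?_⟩
      · intro x
        have := hφ (φ.symm (x.1, (φ x.2).2))
        rw [← this]; simp
      · intro e
        have : ((⟨Circle.exp e, e.2⟩ : U), (φ e).2) = φ e := by
          ext
          · exact congrArg _ (hφ e).symm
          · rfl
        simp only [this]; simp)
    (by intro z; exact ⟨_, Circle.exp_arg z⟩)
    (by
      intro b
      have := (Circle.isCoveringMap_exp b).discreteTopology_fiber
      exact sphExt_discrete (by omega) _) g
  obtain ⟨W, hW⟩ := ContinuousMap.exists_restrict_eq (Metric.isClosed_sphere) w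
  refine ⟨Circle.exp.comp W, fun x => ?_⟩
  have h1 : W x.1 = w x := congrArg (fun h => h x) hW
  have h2 : Circle.exp (w x) = g x := congrArg (fun h => h x) hw
  simp [h1, h2]

theorem sphExt_sph1 {q : ℕ} (hq : 3 ≤ q) : SphExt q (Sph 1) := by
  let r := Complex.orthonormalBasisOneI.repr
  let h : Circle ≃ₜ Sph 1 :=
  { toFun z := ⟨r (z : ℂ), by rw [mem_sphere_zero_iff_norm, r.norm_map]; exact Circle.norm_coe z⟩
    invFun y := ⟨r.symm y.1, by
      have h1 : ‖r.symm y.1‖ = 1 := by rw [r.symm.norm_map]; simp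
      exact mem_sphere_zero_iff_norm.2 h1⟩
    left_inv z := by ext; simp
    right_inv y := by ext1; simp
    continuous_toFun := by fun_prop
    continuous_invFun := by fun_prop }
  exact sphExt_homeo h (sphExt_circle hq)

theorem sphExt_torus {q m : ℕ} (hq : 3 ≤ q) : SphExt q (Torus m) := by
  intro g
  have := fun i => sphExt_sph1 hq ⟨fun x => g x i, by fun_prop⟩
  choose G hG using this
  refine ⟨⟨fun x i => G i x, by fun_prop⟩, fun x => ?_⟩
  ext1 i
  exact hG i x

theorem stmt_7 (k m n n' : ℕ) (hk : 3 ≤ k) (hm : 1 ≤ m)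
    {E B B' : Type*} [TopologicalSpace E] [TopologicalSpace B] [TopologicalSpace B']
    [Nonempty B] [ConnectedSpace B] [T2Space B] [SecondCountableTopology B]
    [ChartedSpace (EuclideanSpace ℝ (Fin n)) B]
    [Nonempty B'] [ConnectedSpace B'] [T2Space B'] [SecondCountableTopology B']
    [ChartedSpace (EuclideanSpace ℝ (Fin n')) B']
    (p : C(E, B)) (hp : IsBundleWithFiber (Sph (k - 1)) ⇑p)
    (f : C(B', B)) (hf : IsBundleWithFiber (Torus m) ⇑f) :
    (∃ q : ℕ, 1 ≤ q ∧ ¬ PiSurjUpToHomotopy q p) ↔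
      (∃ q : ℕ, 1 ≤ q ∧ ¬ PiSurjUpToHomotopy q (pullbackProj ⇑p ⇑f)) := by

  have hsn : ∀ n : ℕ, Nonempty (Sph n) := fun n =>
    ⟨⟨EuclideanSpace.single 0 1, by simp⟩⟩
  constructor
  · rintro ⟨q, hq, hnot⟩
    by_contra hcon
    push Not at hcon
    apply hnot
    intro u
    by_cases h3 : 3 ≤ q
    · have := hsn 1
      obtain ⟨u', hu'⟩ := bundle_sphere_lift hf (sphExt_torus h3) u
      obtain ⟨w, hw⟩ := hcon q hq u'
      refine ⟨⟨fun x => (w x).1.2, by fun_prop⟩, ?_⟩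
      have h1 := ContinuousMap.Homotopic.comp (ContinuousMap.Homotopic.refl f) hw
      rw [hu'] at h1
      convert h1 using 1
      ext x
      exact (w x).2.symm
    · have := hsn (k - 1)
      obtain ⟨w, hw⟩ := bundle_sphere_lift hp (sphExt_sphere (by omega : q ≤ k - 1)) u
      exact ⟨w, by rw [hw]⟩
  · rintro ⟨q, hq, hnot⟩
    refine ⟨q, hq, fun hs => hnot fun u' => ?_⟩
    obtain ⟨w, hw⟩ := hs (f.comp u')
    obtain ⟨G, hG⟩ := lift_of_homotopic (hasTransport_of_bundle hp) hw ⟨w, rfl⟩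
    refine ⟨⟨fun x => ⟨(u' x, G x), (congrArg (fun h => h x) hG).symm⟩, by fun_prop⟩, ?_⟩
    exact ContinuousMap.Homotopic.refl _
end
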